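/- arXiv:2411.08110 — 2 statements merged into one kernel-verified Lean document; each statement's English description precedes it below -/
import Mathlib

section
/- A single-copy tester {T^i}_{i=1}^N on ℂ^{d_I}⊗ℂ^{d_O} is a convex combination of memory-less testers (i.e., T^i = ∑_λ p_λ ρ^λ ⊗ M^{i|λ} for a finite probability distribution (p_λ), states ρ^λ on ℂ^{d_I}, and N-outcome POVMs {M^{i|λ}}_i on ℂ^{d_O}) if and only if there exist d_E ≥ 1, a separable state ρ_{IE} on ℂ^{d_I}⊗ℂ^{d_E}, and an N-outcome POVM {M^i_{EO}} on ℂ^{d_E}⊗ℂ^{d_O} such that T^i = ρ_{IE} * M^i_{EO} for all i. -/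
open Matrix BigOperators ComplexOrder

noncomputable section

/-- A quantum state on a finite-dimensional system: a positive semidefinite matrix of trace one. -/
def IsState {n : Type*} [Fintype n] (ρ : Matrix n n ℂ) : Prop :=
  ρ.PosSemidef ∧ ρ.trace = 1

/-- A POVM: a finite family of positive semidefinite matrices summing to the identity. -/
def IsPOVM {n ι : Type*} [Fintype n] [DecidableEq n] [Fintype ι]
    (M : ι → Matrix n n ℂ) : Prop :=
  (∀ i, (M i).PosSemidef) ∧ ∑ i, M i = (1 : Matrix n n ℂ)

/-- The link product `X * Y = Tr_E[(X^{T_E} ⊗ 1_B)(1_A ⊗ Y)]`, written out entrywise. -/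
def linkE {A E B : Type*} [Fintype E]
    (X : Matrix (A × E) (A × E) ℂ) (Y : Matrix (E × B) (E × B) ℂ) :
    Matrix (A × B) (A × B) ℂ :=
  Matrix.of fun p q => ∑ e : E, ∑ f : E, X (p.1, f) (q.1, e) * Y (f, p.2) (e, q.2)

/-- A single-copy tester on `A ⊗ B`: `T^i = ρ_{AE} * (M^i_{EB})ᵀ`. -/
def IsTester {A B : Type*} [Fintype A] [DecidableEq A] [Fintype B] [DecidableEq B]
    {N : ℕ} (T : Fin N → Matrix (A × B) (A × B) ℂ) : Prop :=
  ∃ (dE : ℕ), 1 ≤ dE ∧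
    ∃ (ρ : Matrix (A × Fin dE) (A × Fin dE) ℂ)
      (M : Fin N → Matrix (Fin dE × B) (Fin dE × B) ℂ),
      IsState ρ ∧ IsPOVM M ∧ ∀ i, T i = linkE ρ (M i)ᵀ

/-- A separable bipartite state. -/
def IsSepState {A B : Type*} [Fintype A] [Fintype B]
    (ρ : Matrix (A × B) (A × B) ℂ) : Prop :=
  ∃ (L : ℕ) (p : Fin L → ℝ)
    (ρA : Fin L → Matrix A A ℂ) (ρB : Fin L → Matrix B B ℂ),
    (∀ l, 0 ≤ p l) ∧ (∑ l, p l = 1) ∧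
    (∀ l, IsState (ρA l) ∧ IsState (ρB l)) ∧
    ρ = ∑ l, (p l : ℂ) • Matrix.kroneckerMap (· * ·) (ρA l) (ρB l)

/-- A convex combination of memory-less single-copy testers:
`T^i = ∑_λ p_λ ρ^λ ⊗ M^{i|λ}` with states `ρ^λ` and POVMs `{M^{i|λ}}_i`. -/
def IsConvexCombMemoryless {dI dO N : ℕ}
    (T : Fin N → Matrix (Fin dI × Fin dO) (Fin dI × Fin dO) ℂ) : Prop :=
  ∃ (L : ℕ) (p : Fin L → ℝ) (ρ : Fin L → Matrix (Fin dI) (Fin dI) ℂ)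
    (M : Fin L → Fin N → Matrix (Fin dO) (Fin dO) ℂ),
    (∀ l, 0 ≤ p l) ∧ (∑ l, p l = 1) ∧
    (∀ l, IsState (ρ l)) ∧ (∀ l, IsPOVM (M l)) ∧
    ∀ i, T i = ∑ l, (p l : ℂ) • Matrix.kroneckerMap (· * ·) (ρ l) (M l i)

/-- The matrix `Tr_E[(τᵀ ⊗ 1_B) Y]` on `B`, obtained by linking `Y` with `τ` on all of `E`. -/
def partialContract {E B : Type*} [Fintype E]
    (τ : Matrix E E ℂ) (Y : Matrix (E × B) (E × B) ℂ) : Matrix B B ℂ :=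
  Matrix.of fun b c => ∑ e : E, ∑ f : E, τ f e * Y (f, b) (e, c)

lemma linkE_sum_smul_kronecker {A E B ι : Type*} [Fintype E] [Fintype ι] (p : ι → ℂ)
    (σ : ι → Matrix A A ℂ) (τ : ι → Matrix E E ℂ) (Y : Matrix (E × B) (E × B) ℂ) :
    linkE (∑ l, p l • Matrix.kroneckerMap (· * ·) (σ l) (τ l)) Y =
      ∑ l, p l • Matrix.kroneckerMap (· * ·) (σ l) (partialContract (τ l) Y) := by
  ext ⟨a, b⟩ ⟨a', b'⟩
  simp only [linkE, partialContract, Matrix.of_apply, Matrix.sum_apply, Matrix.smul_apply,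
    Matrix.kroneckerMap_apply, smul_eq_mul, Finset.sum_mul, Finset.mul_sum]
  simp_rw [Finset.sum_comm (γ := ι)]
  refine Finset.sum_congr rfl fun l _ => Finset.sum_congr rfl fun e _ =>
    Finset.sum_congr rfl fun f _ => by ring

lemma Matrix.PosSemidef.partialContract {E B : Type*} [Fintype E] [Fintype B]
    {τ : Matrix E E ℂ} {Y : Matrix (E × B) (E × B) ℂ} (hτ : τ.PosSemidef) (hY : Y.PosSemidef) :
    (partialContract τ Y).PosSemidef := by
  classical
  obtain ⟨C, rfl⟩ : ∃ C : Matrix E E ℂ, τ = Cᴴ * C := by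
    open scoped MatrixOrder in
    exact CStarAlgebra.nonneg_iff_eq_star_mul_self.mp hτ.nonneg
  let V : E → Matrix (E × B) B ℂ := fun k => Matrix.of fun x c => if x.2 = c then C k x.1 else 0
  have h : _root_.partialContract (Cᴴ * C) Y = ∑ k, (V k)ᴴ * Y * V k := by
    ext b c
    simp only [_root_.partialContract, V, Matrix.of_apply, Matrix.sum_apply, Matrix.mul_apply,
      Matrix.conjTranspose_apply, Fintype.sum_prod_type, apply_ite star, star_zero, ite_mul,
      zero_mul, mul_ite, mul_zero, Finset.sum_ite_eq', Finset.mem_univ, if_true, Finset.sum_mul]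
    rw [eq_comm, Finset.sum_comm]
    refine Finset.sum_congr rfl fun e _ => ?_
    rw [Finset.sum_comm]
    exact Finset.sum_congr rfl fun f _ => Finset.sum_congr rfl fun k _ => by ring
  rw [h]
  exact Matrix.posSemidef_sum _ fun k _ => hY.conjTranspose_mul_mul_same (V k)

lemma partialContract_one {E B : Type*} [Fintype E] [DecidableEq E] [DecidableEq B]
    (τ : Matrix E E ℂ) : partialContract τ (1 : Matrix (E × B) (E × B) ℂ) = τ.trace • 1 := by
  ext b c
  by_cases h : b = c <;>
    simp [partialContract, Matrix.one_apply, Matrix.trace, h]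

lemma partialContract_sum {E B ι : Type*} [Fintype E] [Fintype ι]
    (τ : Matrix E E ℂ) (Y : ι → Matrix (E × B) (E × B) ℂ) :
    partialContract τ (∑ i, Y i) = ∑ i, partialContract τ (Y i) := by
  ext b c
  simp only [partialContract, Matrix.of_apply, Matrix.sum_apply, Finset.mul_sum]
  simp_rw [Finset.sum_comm (γ := ι)]

lemma IsPOVM.partialContract {E B ι : Type*} [Fintype E] [DecidableEq E] [Fintype B]
    [DecidableEq B] [Fintype ι] {τ : Matrix E E ℂ} {M : ι → Matrix (E × B) (E × B) ℂ}
    (hτ : IsState τ) (hM : IsPOVM M) : IsPOVM fun i => partialContract τ (M i) :=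
  ⟨fun i => hτ.1.partialContract (hM.1 i), by
    rw [← partialContract_sum, hM.2, partialContract_one, hτ.2, one_smul]⟩

lemma IsSepState.isState {A B : Type*} [Fintype A] [Fintype B]
    {ρ : Matrix (A × B) (A × B) ℂ} (h : IsSepState ρ) : IsState ρ := by
  classical
  obtain ⟨L, p, σ, τ, hp, hp1, hs, rfl⟩ := h
  refine ⟨Matrix.posSemidef_sum _ fun l _ => ?_, ?_⟩
  · exact ((hs l).1.1.kronecker (hs l).2.1).smul (by exact_mod_cast hp l)
  · have htr (l : Fin L) : (Matrix.kroneckerMap (· * ·) (σ l) (τ l)).trace = 1 := by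
      rw [Matrix.trace_kronecker, (hs l).1.2, (hs l).2.2, one_mul]
    simp only [Matrix.trace_sum, Matrix.trace_smul, htr, smul_eq_mul, mul_one]
    exact_mod_cast hp1

lemma isState_diagonal_single {n : Type*} [Fintype n] [DecidableEq n] (l : n) :
    IsState (Matrix.diagonal (Pi.single l (1 : ℂ))) := by
  refine ⟨Matrix.PosSemidef.diagonal ?_, by simp [Matrix.trace_diagonal]⟩
  exact Pi.single_nonneg.mpr zero_le_one

/-- The measurement `∑ₗ |l⟩⟨l| ⊗ M^{i|l}`, controlled by a classical register. -/
def controlledPOVM {n B ι : Type*} [Fintype n] [DecidableEq n]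
    (M : n → ι → Matrix B B ℂ) (i : ι) : Matrix (n × B) (n × B) ℂ :=
  ∑ l, Matrix.kroneckerMap (· * ·) (Matrix.diagonal (Pi.single l (1 : ℂ))) (M l i)

lemma controlledPOVM_apply {n B ι : Type*} [Fintype n] [DecidableEq n]
    (M : n → ι → Matrix B B ℂ) (i : ι) (x y : n × B) :
    controlledPOVM M i x y = if x.1 = y.1 then M x.1 i x.2 y.2 else 0 := by
  simp only [controlledPOVM, Matrix.sum_apply, Matrix.kroneckerMap_apply, Matrix.diagonal_apply,
    Pi.single_apply]
  split_ifs <;> simp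

lemma IsPOVM.controlledPOVM {n B ι : Type*} [Fintype n] [DecidableEq n] [Fintype B]
    [DecidableEq B] [Fintype ι] {M : n → ι → Matrix B B ℂ} (hM : ∀ l, IsPOVM (M l)) :
    IsPOVM (controlledPOVM M) := by
  refine ⟨fun i => Matrix.posSemidef_sum _ fun l _ =>
    (isState_diagonal_single l).1.kronecker ((hM l).1 i), ?_⟩
  ext ⟨l, b⟩ ⟨m, c⟩
  simp only [Matrix.sum_apply, controlledPOVM_apply, Matrix.one_apply, Prod.mk.injEq]
  by_cases h : l = m
  · subst h
    simpa [Matrix.sum_apply, Matrix.one_apply] using congr_fun₂ (hM l).2 b c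
  · simp [h]

lemma partialContract_controlledPOVM {n B ι : Type*} [Fintype n] [DecidableEq n]
    (M : n → ι → Matrix B B ℂ) (i : ι) (l : n) :
    partialContract (Matrix.diagonal (Pi.single l (1 : ℂ))) (controlledPOVM M i) = M l i := by
  ext b c
  simp [partialContract, controlledPOVM_apply, Matrix.diagonal_apply, Pi.single_apply]

/-- A single-copy tester is a convex combination of memory-less testers if
and only if it can be realized as `T^i = ρ_{IE} * M^i_{EO}` with a *separable*
state `ρ_{IE}` and a POVM `{M^i_{EO}}`. -/
theorem memoryless_convex_iff_separable_state {dI dO N : ℕ}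
    (T : Fin N → Matrix (Fin dI × Fin dO) (Fin dI × Fin dO) ℂ)
    (hT : IsTester T) :
    IsConvexCombMemoryless T ↔
      ∃ (dE : ℕ), 1 ≤ dE ∧
        ∃ (ρ : Matrix (Fin dI × Fin dE) (Fin dI × Fin dE) ℂ)
          (M : Fin N → Matrix (Fin dE × Fin dO) (Fin dE × Fin dO) ℂ),
          IsState ρ ∧ IsSepState ρ ∧ IsPOVM M ∧ ∀ i, T i = linkE ρ (M i) := by
  constructor
  · rintro ⟨L, p, σ, M, hp, hp1, hσ, hM, hTM⟩
    have hL : 1 ≤ L := by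
      rcases Nat.eq_zero_or_pos L with rfl | h
      · simp at hp1
      · exact h
    have hsep : IsSepState (∑ l, (p l : ℂ) • Matrix.kroneckerMap (· * ·) (σ l)
        (Matrix.diagonal (Pi.single l (1 : ℂ)))) :=
      ⟨L, p, σ, _, hp, hp1, fun l => ⟨hσ l, isState_diagonal_single l⟩, rfl⟩
    refine ⟨L, hL, _, controlledPOVM M, hsep.isState, hsep, .controlledPOVM hM, fun i => ?_⟩
    simp only [hTM, linkE_sum_smul_kronecker, partialContract_controlledPOVM]
  · rintro ⟨dE, -, _, M, -, ⟨L, p, σ, τ, hp, hp1, hs, rfl⟩, hM, hTM⟩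
    exact ⟨L, p, σ, fun l i => partialContract (τ l) (M i), hp, hp1, fun l => (hs l).1,
      fun l => .partialContract (hs l).2 hM,
      fun i => (hTM i).trans (linkE_sum_smul_kronecker _ _ _ _)⟩
end
end

section
/- For every channel ensemble {(q_i, C^i)}_{i=1}^N with Choi matrices C^i on ℂ^{d_I}⊗ℂ^{d_O} and every d_E ≥ 1, the maximum of ∑_i q_i Tr(T^i C^i) over all memory-d_E single-copy testers {T^i} on ℂ^{d_I}⊗ℂ^{d_O} equals the maximum of ∑_i q_i Tr(T̃^i C̃^i) over all memory-less (d_{E'} = 1) single-copy testers {T̃^i} on (ℂ^{d_I}⊗ℂ^{d_E})⊗(ℂ^{d_O}⊗ℂ^{d_E}), where C̃^i := C^i ⊗ Φ_{EE'} (suitably reordered) is the Choi matrix of the channel C^i ⊗ id_{d_E} and Φ_{EE'} := ∑_{k,l=0}^{d_E−1} |k⟩⟨l| ⊗ |k⟩⟨l| is the Choi matrix of the identity channel on ℂ^{d_E}. -/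
open Matrix BigOperators ComplexOrder

noncomputable section

/-- The Choi matrix of the channel `C ⊗ id_{d_E}`, i.e. `C ⊗ Φ_{EE'}` with
`Φ_{EE'} = ∑_{k,l} |k⟩⟨l| ⊗ |k⟩⟨l|`, reordered onto the index `(I × E) × (O × E')`. -/
def extChoi {dI dO dE : ℕ} (C : Matrix (Fin dI × Fin dO) (Fin dI × Fin dO) ℂ) :
    Matrix ((Fin dI × Fin dE) × (Fin dO × Fin dE))
           ((Fin dI × Fin dE) × (Fin dO × Fin dE)) ℂ :=
  Matrix.of fun p q =>
    C (p.1.1, p.2.1) (q.1.1, q.2.1) *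
    (if p.1.2 = p.2.2 then 1 else 0) * (if q.1.2 = q.2.2 then 1 else 0)

/-- Exchanging the two tensor factors turns a POVM into a POVM. -/
lemma IsPOVM.submatrix_swap {m n ι : Type*} [Fintype m] [Fintype n] [DecidableEq m]
    [DecidableEq n] [Fintype ι] {M : ι → Matrix (m × n) (m × n) ℂ} (hM : IsPOVM M) :
    IsPOVM fun i => (M i).submatrix (Prod.swap : n × m → m × n) Prod.swap := by
  refine ⟨fun i => (hM.1 i).submatrix _, ?_⟩
  have h := congrArg (fun A => A.submatrix (Prod.swap : n × m → m × n) Prod.swap) hM.2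
  simp only [submatrix_one _ Prod.swap_injective] at h
  rw [← h]
  ext p q
  simp [Matrix.sum_apply]

/-- The outcome weight of a tester with memory `E` on `C` is that of the memory-less tester
obtained by exchanging the factors of the measurement operator, on `C ⊗ id`. -/
lemma trace_linkE_mul_eq_trace_kronecker_mul_extChoi {dI dO dE : ℕ}
    (ρ : Matrix (Fin dI × Fin dE) (Fin dI × Fin dE) ℂ)
    (M : Matrix (Fin dE × Fin dO) (Fin dE × Fin dO) ℂ)
    (C : Matrix (Fin dI × Fin dO) (Fin dI × Fin dO) ℂ) :
    trace (linkE ρ Mᵀ * C) =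
      trace (kroneckerMap (· * ·) ρ (M.submatrix Prod.swap Prod.swap)ᵀ *
        (extChoi C : Matrix ((Fin dI × Fin dE) × (Fin dO × Fin dE))
          ((Fin dI × Fin dE) × (Fin dO × Fin dE)) ℂ)) := by
  have hl : trace (linkE ρ Mᵀ * C) = ∑ a, ∑ b, ∑ a', ∑ b', ∑ e, ∑ f,
      ρ (a, f) (a', e) * M (e, b') (f, b) * C (a', b') (a, b) := by
    simp [trace, mul_apply, linkE, Fintype.sum_prod_type, Finset.sum_mul]
  have hr : trace (kroneckerMap (· * ·) ρ (M.submatrix Prod.swap Prod.swap)ᵀ *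
        (extChoi C : Matrix ((Fin dI × Fin dE) × (Fin dO × Fin dE))
          ((Fin dI × Fin dE) × (Fin dO × Fin dE)) ℂ)) = ∑ a, ∑ f, ∑ b, ∑ a', ∑ e, ∑ b',
      ρ (a, f) (a', e) * M (e, b') (f, b) * C (a', b') (a, b) := by
    simp [trace, mul_apply, extChoi, Fintype.sum_prod_type]
  rw [hl, hr]
  refine Finset.sum_congr rfl fun a _ => ?_
  rw [Finset.sum_comm (s := (Finset.univ : Finset (Fin dE)))]
  refine Finset.sum_congr rfl fun b _ => ?_
  rw [Finset.sum_comm (s := (Finset.univ : Finset (Fin dE)))]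
  refine Finset.sum_congr rfl fun a' _ => ?_
  rw [Finset.sum_comm_cycle]
  exact Finset.sum_congr rfl fun f _ => Finset.sum_comm

/-- Channel discrimination with memory-`d_E` testers reduces to
discrimination of the enlarged ensemble `{q_i, C^i ⊗ id_{d_E}}` with memory-less testers:
the optimal values of the two problems coincide. -/
theorem memory_reduction_to_memoryless {dI dO N dE : ℕ} (hdE : 1 ≤ dE)
    (q : Fin N → ℝ) (hq : (∀ i, 0 ≤ q i) ∧ (∑ i, q i) = 1)
    (C : Fin N → Matrix (Fin dI × Fin dO) (Fin dI × Fin dO) ℂ)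
    (hC : ∀ i, (C i).PosSemidef ∧
      ∀ x x' : Fin dI, (∑ o : Fin dO, C i (x, o) (x', o)) = if x = x' then 1 else 0) :
    sSup {v : ℝ | ∃ (ρ : Matrix (Fin dI × Fin dE) (Fin dI × Fin dE) ℂ)
        (M : Fin N → Matrix (Fin dE × Fin dO) (Fin dE × Fin dO) ℂ),
        IsState ρ ∧ IsPOVM M ∧
        v = ∑ i, q i * (Matrix.trace (linkE ρ (M i)ᵀ * C i)).re} =
    sSup {v : ℝ | ∃ (ρ : Matrix (Fin dI × Fin dE) (Fin dI × Fin dE) ℂ)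
        (M : Fin N → Matrix (Fin dO × Fin dE) (Fin dO × Fin dE) ℂ),
        IsState ρ ∧ IsPOVM M ∧
        v = ∑ i, q i *
          (Matrix.trace (Matrix.kroneckerMap (· * ·) ρ ((M i)ᵀ) *
            (extChoi (C i) : Matrix ((Fin dI × Fin dE) × (Fin dO × Fin dE))
              ((Fin dI × Fin dE) × (Fin dO × Fin dE)) ℂ))).re} := by
  congr 1
  ext v
  constructor
  · rintro ⟨ρ, M, hρ, hM, rfl⟩
    exact ⟨ρ, _, hρ, hM.submatrix_swap, by
      simp only [trace_linkE_mul_eq_trace_kronecker_mul_extChoi]⟩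
  · rintro ⟨ρ, M, hρ, hM, rfl⟩
    exact ⟨ρ, _, hρ, hM.submatrix_swap, by
      simp only [trace_linkE_mul_eq_trace_kronecker_mul_extChoi, submatrix_submatrix,
        Prod.swap_swap_eq, submatrix_id_id]⟩
end
end
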